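/- Suppose Assumption A holds. Then there is a constant C ≥ 0 such that for any x₀, x₀′ ∈ ℝⁿ and u, u′ ∈ 𝒰ᵖ[0,T], ‖x(·;x₀,u) − x(·;x₀′,u′)‖_{Lᵖ([0,T];ℝⁿ)} ≤ C|x₀ − x₀′| + C[∫₀ᵀ(∫₀ᵗ |f(t,s,x(s;x₀,u),u(s)) − f(t,s,x(s;x₀,u),u′(s))|/(t−s)^{1−α} ds)ᵖ dt]^{1/p} + C[∫₀ᵀ(∫₀ᵗ |g(t,s,x(s;x₀,u),u(s)) − g(t,s,x(s;x₀,u),u′(s))| ds)ᵖ dt]^{1/p}. -/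

import Mathlib

open MeasureTheory Set

noncomputable section

/-- Euclidean space `ℝ^k`. -/
abbrev Euc (k : ℕ) := EuclideanSpace ℝ (Fin k)

/-- Admissible controls in `𝒰ᵖ[0,T]`: measurable, `U`-valued, with `ρ(u(·),u₀) ∈ Lᵖ`. -/
def Admissible {d : ℕ} (T p : ℝ) (U : Set (Euc d)) (u₀ : Euc d) (u : ℝ → Euc d) : Prop :=
  Measurable u ∧ (∀ t, u t ∈ U) ∧ IntegrableOn (fun t => ‖u t - u₀‖ ^ p) (Set.Ioc 0 T)

/-- `x` solves the Volterra integral equation with singular and nonsingular kernels for the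
initial condition `x₀` and control `u`, a.e. on `[0,T]`. -/
def IsSolution {n d : ℕ} (T α : ℝ) (f g : ℝ → ℝ → Euc n → Euc d → Euc n)
    (x₀ : Euc n) (u : ℝ → Euc d) (x : ℝ → Euc n) : Prop :=
  ∀ᵐ t ∂(volume.restrict (Set.Ioc 0 T)),
    x t = x₀ + (∫ s in Set.Ioc 0 t, ((t - s) ^ (α - 1)) • f t s (x s) (u s))
        + ∫ s in Set.Ioc 0 t, g t s (x s) (u s)


lemma sub_rpow_integrableOn (t β : ℝ) (ht : 0 < t) (hβ : -1 < β) :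
    IntegrableOn (fun s => (t - s) ^ β) (Ioc 0 t) ∧
      ∫ s in Ioc 0 t, (t - s) ^ β = t ^ (β + 1) / (β + 1) := by
  constructor
  · have h := (intervalIntegral.intervalIntegrable_rpow' (a := 0) (b := t) hβ).comp_sub_left t
    simp only [sub_zero, sub_self] at h
    exact (intervalIntegrable_iff_integrableOn_Ioc_of_le ht.le).1 h.symm
  · rw [← intervalIntegral.integral_of_le ht.le,
      intervalIntegral.integral_comp_sub_left (fun x => x ^ β), sub_self, sub_zero,
      integral_rpow (Or.inl hβ), Real.zero_rpow (by linarith), sub_zero]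

lemma kern_bound (T γ r : ℝ) (hT : 0 ≤ T) (hr : 1 < r) (h : -1 < γ * (r / (r - 1)))
    (k : ℝ → ℝ) (hk0 : ∀ s, 0 ≤ k s) (hkm : Measurable k)
    (hkL : IntegrableOn (fun s => k s ^ r) (Ioc 0 T)) :
    ∃ M, 0 ≤ M ∧ ∀ t ∈ Ioc 0 T, IntegrableOn (fun s => (t - s) ^ γ * k s) (Ioc 0 t) ∧
      ∫ s in Ioc 0 t, (t - s) ^ γ * k s ≤ M := by
  set r' := r / (r - 1) with hr'
  have hc : r'.HolderConjugate r := (Real.HolderConjugate.conjExponent hr).symm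
  have key : ∀ t ∈ Ioc 0 T, IntegrableOn (fun s => (t - s) ^ (γ * r') + k s ^ r) (Ioc 0 t) ∧
      ∀ s ∈ Ioc 0 t, (t - s) ^ γ * k s ≤ (t - s) ^ (γ * r') + k s ^ r := by
    intro t ht
    refine ⟨(sub_rpow_integrableOn t _ ht.1 h).1.add
      (hkL.mono_set (Ioc_subset_Ioc_right ht.2)), ?_⟩
    intro s hs
    have hts : 0 ≤ t - s := sub_nonneg.2 hs.2
    refine (Real.young_inequality_of_nonneg (Real.rpow_nonneg hts γ) (hk0 s) hc).trans ?_
    rw [← Real.rpow_mul hts]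
    refine add_le_add ?_ ?_
    · exact div_le_self (Real.rpow_nonneg hts _) hc.lt.le
    · exact div_le_self (Real.rpow_nonneg (hk0 s) _) hr.le
  refine ⟨T ^ (γ * r' + 1) / (γ * r' + 1) + ∫ s in Ioc 0 T, k s ^ r, ?_, ?_⟩
  · have : 0 ≤ ∫ s in Ioc 0 T, k s ^ r := integral_nonneg fun s => Real.rpow_nonneg (hk0 s) _
    have h2 : 0 ≤ T ^ (γ * r' + 1) / (γ * r' + 1) :=
      div_nonneg (Real.rpow_nonneg hT _) (by linarith)
    linarith
  · intro t ht
    obtain ⟨h1, h2⟩ := key t ht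
    have hi : IntegrableOn (fun s => (t - s) ^ γ * k s) (Ioc 0 t) := by
      refine Integrable.mono' h1 (by fun_prop) ?_
      filter_upwards [ae_restrict_mem measurableSet_Ioc] with s hs
      rw [Real.norm_of_nonneg]
      · exact h2 s hs
      · exact mul_nonneg (Real.rpow_nonneg (sub_nonneg.2 hs.2) _) (hk0 s)
    refine ⟨hi, (setIntegral_mono_on hi h1 measurableSet_Ioc h2).trans ?_⟩
    rw [integral_add (sub_rpow_integrableOn t _ ht.1 h).1
      (hkL.mono_set (Ioc_subset_Ioc_right ht.2)), (sub_rpow_integrableOn t _ ht.1 h).2]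
    refine add_le_add ?_ ?_
    · exact div_le_div_of_nonneg_right
        (Real.rpow_le_rpow ht.1.le ht.2 (by linarith)) (by linarith)
    · exact setIntegral_mono_set hkL
        (Filter.Eventually.of_forall fun s => Real.rpow_nonneg (hk0 s) _)
        (Ioc_subset_Ioc_right ht.2).eventuallyLE

lemma holder_bound (T α p γ r₁ : ℝ) (hT : 0 ≤ T) (hα1 : α < 1) (hp1 : 1 < p) (hαp : 1 < α * p)
    (hγ : α - 1 ≤ γ) (hr₁ : p / (α * p - 1) < r₁)
    (K : ℝ → ℝ) (hK0 : ∀ s, 0 ≤ K s) (hKm : Measurable K)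
    (hKL : IntegrableOn (fun s => K s ^ r₁) (Ioc 0 T)) :
    ∃ M, 0 ≤ M ∧ ∀ t ∈ Ioc 0 T, ∀ e : ℝ → ℝ, Continuous e → (∀ s, 0 ≤ e s) →
      (∫ s in Ioc 0 t, (t - s) ^ γ * (K s * e s)) ^ p ≤ M * ∫ s in Ioc 0 t, e s ^ p := by
  set q := p / (p - 1) with hq
  have hp0 : 0 < p := by linarith
  have hc : p.HolderConjugate q := Real.HolderConjugate.conjExponent hp1
  have hq0 : 0 < q := hc.symm.pos
  have hA : p < r₁ * (α * p - 1) := by rwa [div_lt_iff₀ (by linarith)] at hr₁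
  have hr0 : 0 < r₁ := lt_trans (div_pos hp0 (by linarith)) hr₁
  have hB : q < r₁ * (1 - (1 - α) * q) := by
    have : r₁ * (1 - (1 - α) * q) = r₁ * (α * p - 1) / (p - 1) := by
      rw [hq]; field_simp [show p - 1 ≠ 0 by linarith]; ring
    rw [this, hq]
    exact div_lt_div_of_pos_right hA (by linarith)
  have hqr : q < r₁ := by nlinarith [mul_pos hr0 (mul_pos (sub_pos.2 hα1) hq0)]
  have hC : -1 < γ * q * ((r₁ / q) / (r₁ / q - 1)) := by
    have h1 : (r₁ / q) / (r₁ / q - 1) = r₁ / (r₁ - q) := by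
      field_simp
    rw [h1, ← mul_div_assoc, lt_div_iff₀ (by linarith)]
    have : (α - 1) * (q * r₁) ≤ γ * (q * r₁) :=
      mul_le_mul_of_nonneg_right hγ (by positivity)
    nlinarith
  obtain ⟨M, hM0, hM⟩ := kern_bound T (γ * q) (r₁ / q) hT ((one_lt_div hq0).2 hqr) hC
    (fun s => K s ^ q) (fun s => Real.rpow_nonneg (hK0 s) _) (by fun_prop)
    (by
      refine hKL.congr_fun (fun s _ => ?_) measurableSet_Ioc
      simp only
      rw [← Real.rpow_mul (hK0 s)]
      congr 1
      field_simp)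
  refine ⟨M ^ (p / q), Real.rpow_nonneg hM0 _, ?_⟩
  intro t ht e he he0
  obtain ⟨hi, hb⟩ := hM t ht
  have hk0 : ∀ s ∈ Ioc 0 t, 0 ≤ (t - s) ^ γ * K s := fun s hs =>
    mul_nonneg (Real.rpow_nonneg (sub_nonneg.2 hs.2) _) (hK0 s)
  have hkq : ∀ s ∈ Ioc 0 t, ((t - s) ^ γ * K s) ^ q = (t - s) ^ (γ * q) * K s ^ q := by
    intro s hs
    rw [Real.mul_rpow (Real.rpow_nonneg (sub_nonneg.2 hs.2) _) (hK0 s),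
      ← Real.rpow_mul (sub_nonneg.2 hs.2)]
  have hmem1 : MemLp e (ENNReal.ofReal p) (volume.restrict (Ioc 0 t)) := by
    rw [← integrable_norm_rpow_iff (by fun_prop) (by simpa using hp0) (by simp),
      ENNReal.toReal_ofReal hp0.le]
    have hcont : Continuous fun s => ‖e s‖ ^ p :=
      he.norm.rpow_const fun s => Or.inr hp0.le
    exact (hcont.integrableOn_Icc (a := 0) (b := t)).mono_set Ioc_subset_Icc_self
  have hmem2 : MemLp (fun s => (t - s) ^ γ * K s) (ENNReal.ofReal q)
      (volume.restrict (Ioc 0 t)) := by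
    rw [← integrable_norm_rpow_iff (by fun_prop) (by simpa using hq0) (by simp),
      ENNReal.toReal_ofReal hq0.le]
    refine IntegrableOn.congr_fun hi (fun s hs => ?_) measurableSet_Ioc
    rw [Real.norm_of_nonneg (hk0 s hs), hkq s hs]
  have hH := integral_mul_le_Lp_mul_Lq_of_nonneg hc
    (Filter.Eventually.of_forall he0)
    (by filter_upwards [ae_restrict_mem measurableSet_Ioc] with s hs using hk0 s hs)
    hmem1 hmem2
  rw [setIntegral_congr_fun measurableSet_Ioc hkq] at hH
  have hL : ∫ s in Ioc 0 t, (t - s) ^ γ * (K s * e s)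
      = ∫ s in Ioc 0 t, e s * ((t - s) ^ γ * K s) := by
    congr 1; ext s; ring
  rw [hL]
  have hE : 0 ≤ ∫ s in Ioc 0 t, e s ^ p := integral_nonneg fun s => Real.rpow_nonneg (he0 s) _
  have hI : 0 ≤ ∫ s in Ioc 0 t, (t - s) ^ (γ * q) * K s ^ q := 
    setIntegral_nonneg measurableSet_Ioc fun s hs => by
      rw [← hkq s hs]; exact Real.rpow_nonneg (hk0 s hs) _
  have h0 : 0 ≤ ∫ s in Ioc 0 t, e s * ((t - s) ^ γ * K s) :=
    setIntegral_nonneg measurableSet_Ioc fun s hs => mul_nonneg (he0 s) (hk0 s hs)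
  refine (Real.rpow_le_rpow h0 hH hp0.le).trans ?_
  rw [Real.mul_rpow (Real.rpow_nonneg hE _) (Real.rpow_nonneg hI _), ← Real.rpow_mul hE,
    ← Real.rpow_mul hI, one_div_mul_cancel hp0.ne', Real.rpow_one, mul_comm]
  refine mul_le_mul_of_nonneg_right ?_ hE
  rw [one_div, inv_mul_eq_div]
  exact Real.rpow_le_rpow hI hb (by positivity)

lemma gronwall_int (T L : ℝ) (hT : 0 < T) (hL : 0 ≤ L) (E D : ℝ → ℝ) (hE : Continuous E)
    (hE0 : ∀ s, 0 ≤ E s) (hD0 : ∀ t ∈ Ioc 0 T, 0 ≤ D t) (hD : IntegrableOn D (Ioc 0 T))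
    (h : ∀ᵐ t ∂(volume.restrict (Ioc 0 T)), E t ≤ D t + L * ∫ s in Ioc 0 t, E s) :
    ∫ t in Ioc 0 T, E t ≤ (∫ t in Ioc 0 T, D t) * Real.exp (L * T) := by
  set φ : ℝ → ℝ := fun t => ∫ s in (0:ℝ)..t, E s with hφ
  have hφc : Continuous φ := intervalIntegral.continuous_primitive
    (fun a b => hE.intervalIntegrable a b) 0
  set Φ := ∫ t in Ioc 0 T, D t with hΦ
  have hφ0 : ∀ t, 0 ≤ t → 0 ≤ φ t := fun t ht =>
    intervalIntegral.integral_nonneg ht fun s _ => hE0 s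
  have hΦ0 : 0 ≤ Φ := setIntegral_nonneg measurableSet_Ioc hD0
  set y : ℝ → ℝ := fun t => Φ + L * ∫ s in (0:ℝ)..t, φ s with hy
  have hy0 : ∀ t, 0 ≤ t → 0 ≤ y t := fun t ht =>
    add_nonneg hΦ0 (mul_nonneg hL (intervalIntegral.integral_nonneg ht fun s hs => hφ0 s hs.1))
  have hφy : ∀ t ∈ Icc 0 T, φ t ≤ y t := by
    intro t ht
    have hDt : IntegrableOn D (Ioc 0 t) := hD.mono_set (Ioc_subset_Ioc_right ht.2)
    have hφi : IntegrableOn (fun s => L * φ s) (Ioc 0 t) :=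
      ((continuous_const.mul hφc).integrableOn_Icc (a := 0) (b := t)).mono_set Ioc_subset_Icc_self
    have h1 : ∫ s in Ioc 0 t, E s ≤ ∫ s in Ioc 0 t, (D s + L * φ s) := by
      refine setIntegral_mono_ae_restrict
        ((hE.integrableOn_Icc (a := 0) (b := t)).mono_set Ioc_subset_Icc_self) (hDt.add hφi) ?_
      have hsub : Ioc 0 t ⊆ Ioc 0 T := Ioc_subset_Ioc_right ht.2
      have h' := ae_restrict_of_ae_restrict_of_subset hsub h
      filter_upwards [h', ae_restrict_mem measurableSet_Ioc] with s hs hs'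
      simpa only [hφ, intervalIntegral.integral_of_le hs'.1.le] using hs
    rw [integral_add hDt hφi, integral_const_mul] at h1
    have h2 : ∫ s in Ioc 0 t, D s ≤ Φ := by
      refine setIntegral_mono_set hD ?_ (Ioc_subset_Ioc_right ht.2).eventuallyLE
      filter_upwards [ae_restrict_mem measurableSet_Ioc] with s hs using hD0 s hs
    simp only [hy]
    rw [intervalIntegral.integral_of_le ht.1]
    have h3 : φ t = ∫ s in Ioc 0 t, E s := intervalIntegral.integral_of_le ht.1
    linarith
  have hyd : ∀ t, HasDerivAt y (L * φ t) t := fun t =>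
    ((hφc.integral_hasStrictDerivAt 0 t).hasDerivAt.const_mul L).const_add Φ
  have hg := norm_le_gronwallBound_of_norm_deriv_right_le (f := y) (f' := fun t => L * φ t)
    (δ := Φ) (K := L) (ε := 0) (a := 0) (b := T)
    (fun t _ => (hyd t).continuousAt.continuousWithinAt)
    (fun t _ => (hyd t).hasDerivWithinAt)
    (by simp [hy, abs_of_nonneg hΦ0])
    (fun t ht => by
      rw [Real.norm_of_nonneg (mul_nonneg hL (hφ0 t ht.1)), Real.norm_of_nonneg (hy0 t ht.1),
        add_zero]
      exact mul_le_mul_of_nonneg_left (hφy t ⟨ht.1, ht.2.le⟩) hL) T ⟨hT.le, le_rfl⟩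
  rw [gronwallBound_ε0, sub_zero, Real.norm_of_nonneg (hy0 T hT.le)] at hg
  have h4 : φ T = ∫ s in Ioc 0 T, E s := intervalIntegral.integral_of_le hT.le
  rw [← h4]
  exact (hφy T ⟨hT.le, le_rfl⟩).trans hg

lemma vol_measurable (F : ℝ → ℝ → ℝ) (hF : Measurable (Function.uncurry F)) :
    Measurable fun t => ∫ s in Ioc 0 t, F t s := by
  have hS : MeasurableSet {z : ℝ × ℝ | 0 < z.2 ∧ z.2 ≤ z.1} :=
    (measurableSet_lt measurable_const measurable_snd).inter
      (measurableSet_le measurable_snd measurable_fst)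
  have h1 := (hF.indicator hS).stronglyMeasurable
  have h2 := (h1.integral_prod_right' (ν := (volume : Measure ℝ))).measurable
  have h3 : (fun t => ∫ s in Ioc 0 t, F t s) = fun t => ∫ s,
      {z : ℝ × ℝ | 0 < z.2 ∧ z.2 ≤ z.1}.indicator (Function.uncurry F) (t, s) := by
    ext t
    rw [← integral_indicator measurableSet_Ioc]
    rfl
  rw [h3]
  exact h2

lemma vol_pow_integrable (T p M : ℝ) (hp : 0 ≤ p) (F : ℝ → ℝ → ℝ)
    (hF : Measurable (Function.uncurry F)) (hF0 : ∀ t ∈ Ioc 0 T, ∀ s ∈ Ioc 0 t, 0 ≤ F t s)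
    (hM : ∀ t ∈ Ioc 0 T, ∫ s in Ioc 0 t, F t s ≤ M) :
    IntegrableOn (fun t => (∫ s in Ioc 0 t, F t s) ^ p) (Ioc 0 T) := by
  have hm := vol_measurable F hF
  refine Measure.integrableOn_of_bounded (M := M ^ p) (by simp)
    (hm.pow_const p).aestronglyMeasurable ?_
  filter_upwards [ae_restrict_mem measurableSet_Ioc] with t ht
  have h0 : 0 ≤ ∫ s in Ioc 0 t, F t s := setIntegral_nonneg measurableSet_Ioc (hF0 t ht)
  rw [Real.norm_of_nonneg (Real.rpow_nonneg h0 _)]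
  exact Real.rpow_le_rpow h0 (hM t ht) hp

lemma one_kernel {n d : ℕ} (T p γ : ℝ) (hp : 0 ≤ p) (U : Set (Euc d))
    (h : ℝ → ℝ → Euc n → Euc d → Euc n)
    (hm : Measurable fun q : ℝ × ℝ × Euc n × Euc d => h q.1 q.2.1 q.2.2.1 q.2.2.2)
    (K₀ K : ℝ → ℝ) (hK_nonneg : ∀ s, 0 ≤ K s)
    (hlip : ∀ t s : ℝ, 0 ≤ s → s ≤ t → t ≤ T →
      ∀ (x x' : Euc n) (u u' : Euc d), u ∈ U → u' ∈ U →
        ‖h t s x u - h t s x' u'‖ ≤ K s * (‖x - x'‖ + ‖u - u'‖))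
    (hzero : ∀ t s : ℝ, 0 ≤ s → s ≤ t → t ≤ T → ∀ u : Euc d, u ∈ U → ‖h t s 0 u‖ ≤ K₀ s)
    (N₀ N : ℝ)
    (hN₀ : ∀ t ∈ Ioc 0 T, IntegrableOn (fun s => (t - s) ^ γ * K₀ s) (Ioc 0 t) ∧
      ∫ s in Ioc 0 t, (t - s) ^ γ * K₀ s ≤ N₀)
    (hN : ∀ t ∈ Ioc 0 T, IntegrableOn (fun s => (t - s) ^ γ * K s) (Ioc 0 t) ∧
      ∫ s in Ioc 0 t, (t - s) ^ γ * K s ≤ N)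
    (x x' : ℝ → Euc n) (hx : Continuous x) (hx' : Continuous x')
    (u u' : ℝ → Euc d) (hu : Measurable u) (hu' : Measurable u')
    (huU : ∀ t, u t ∈ U) (huU' : ∀ t, u' t ∈ U) :
    (∀ t ∈ Ioc 0 T,
      ‖(∫ s in Ioc 0 t, ((t - s) ^ γ) • h t s (x s) (u s))
        - ∫ s in Ioc 0 t, ((t - s) ^ γ) • h t s (x' s) (u' s)‖
      ≤ (∫ s in Ioc 0 t, (t - s) ^ γ * ‖h t s (x s) (u s) - h t s (x s) (u' s)‖)
        + ∫ s in Ioc 0 t, (t - s) ^ γ * (K s * ‖x s - x' s‖)) ∧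
    IntegrableOn (fun t => (∫ s in Ioc 0 t,
      (t - s) ^ γ * ‖h t s (x s) (u s) - h t s (x s) (u' s)‖) ^ p) (Ioc 0 T) := by
  have hjm : ∀ (y : ℝ → Euc n) (v : ℝ → Euc d), Continuous y → Measurable v →
      Measurable fun z : ℝ × ℝ => h z.1 z.2 (y z.2) (v z.2) := by
    intro y v hy hv
    have h1 : Measurable fun z : ℝ × ℝ => (z.1, z.2, y z.2, v z.2) := 
      measurable_fst.prodMk (measurable_snd.prodMk
        ((hy.measurable.comp measurable_snd).prodMk (hv.comp measurable_snd)))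
    exact hm.comp h1
  have hsm : ∀ (y : ℝ → Euc n) (v : ℝ → Euc d), Continuous y → Measurable v → ∀ t,
      Measurable fun s : ℝ => h t s (y s) (v s) := fun y v hy hv t =>
    (hjm y v hy hv).comp measurable_prodMk_left
  have hk : ∀ t s : ℝ, s ∈ Ioc 0 t → 0 ≤ (t - s) ^ γ := fun t s hs =>
    Real.rpow_nonneg (sub_nonneg.2 hs.2) _
  have hbd : ∀ y : ℝ → Euc n, Continuous y → ∃ X, 0 ≤ X ∧ ∀ s ∈ Icc 0 T, ‖y s‖ ≤ X := by
    intro y hy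
    obtain ⟨X, hX⟩ := isCompact_Icc.exists_bound_of_continuousOn (s := Icc 0 T) hy.continuousOn
    exact ⟨max X 0, le_max_right _ _, fun s hs => (hX s hs).trans (le_max_left _ _)⟩
  have hgrow : ∀ (y : ℝ → Euc n) (v : ℝ → Euc d) (X : ℝ), (∀ s ∈ Icc 0 T, ‖y s‖ ≤ X) →
      (∀ t, v t ∈ U) → ∀ t ∈ Ioc 0 T, ∀ s ∈ Ioc 0 t,
      (t - s) ^ γ * ‖h t s (y s) (v s)‖ ≤ (t - s) ^ γ * K₀ s + X * ((t - s) ^ γ * K s) := by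
    intro y v X hX hv t ht s hs
    have h1 := hlip t s hs.1.le hs.2 ht.2 (y s) 0 (v s) (v s) (hv s) (hv s)
    have h2 := hzero t s hs.1.le hs.2 ht.2 (v s) (hv s)
    have h3 := hX s ⟨hs.1.le, hs.2.trans ht.2⟩
    rw [sub_zero, sub_self, norm_zero, add_zero] at h1
    have h4 : ‖h t s (y s) (v s)‖ ≤ K₀ s + X * K s := by
      have := norm_le_norm_add_norm_sub' (h t s (y s) (v s)) (h t s 0 (v s))
      nlinarith [mul_le_mul_of_nonneg_left h3 (hK_nonneg s)]
    calc _ ≤ (t - s) ^ γ * (K₀ s + X * K s) := mul_le_mul_of_nonneg_left h4 (hk t s hs)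
      _ = _ := by ring
  have hint : ∀ (y : ℝ → Euc n) (v : ℝ → Euc d), Continuous y → Measurable v →
      (∀ t, v t ∈ U) → ∀ t ∈ Ioc 0 T,
      IntegrableOn (fun s => ((t - s) ^ γ) • h t s (y s) (v s)) (Ioc 0 t) := by
    intro y v hy hv hvU t ht
    obtain ⟨X, hX0, hX⟩ := hbd y hy
    refine Integrable.mono' ((hN₀ t ht).1.add ((hN t ht).1.const_mul X)) ?_ ?_
    · have := hsm y v hy hv t
      have h4 : Measurable fun s : ℝ => (t - s) ^ γ := by fun_prop
      exact (h4.smul this).aestronglyMeasurable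
    · filter_upwards [ae_restrict_mem measurableSet_Ioc] with s hs
      rw [norm_smul, Real.norm_of_nonneg (hk t s hs)]
      exact hgrow y v X hX hvU t ht s hs
  have hintn : ∀ t ∈ Ioc 0 T, IntegrableOn
      (fun s => (t - s) ^ γ * ‖h t s (x s) (u s) - h t s (x s) (u' s)‖) (Ioc 0 t) := by
    intro t ht
    refine IntegrableOn.congr_fun
      ((hint x u hx hu huU t ht).sub (hint x u' hx hu' huU' t ht)).norm (fun s hs => ?_)
      measurableSet_Ioc
    simp only [Pi.sub_apply]
    rw [← smul_sub, norm_smul, Real.norm_of_nonneg (hk t s hs)]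
  refine ⟨?_, ?_⟩
  · intro t ht
    rw [← integral_sub (hint x u hx hu huU t ht) (hint x' u' hx' hu' huU' t ht)]
    have hKe : IntegrableOn (fun s => (t - s) ^ γ * (K s * ‖x s - x' s‖)) (Ioc 0 t) := by
      obtain ⟨X, hX0, hX⟩ := hbd (fun s => x s - x' s) (hx.sub hx')
      have h1 := Integrable.bdd_mul (c := X) (hN t ht).1
        (f := fun s => ‖x s - x' s‖) (by fun_prop)
        (by
          filter_upwards [ae_restrict_mem measurableSet_Ioc] with s hs
          simpa using hX s ⟨hs.1.le, hs.2.trans ht.2⟩)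
      refine h1.congr (Filter.Eventually.of_forall fun s => ?_)
      simp only
      ring
    rw [← integral_add (hintn t ht) hKe]
    refine norm_integral_le_of_norm_le ((hintn t ht).add hKe) ?_
    filter_upwards [ae_restrict_mem measurableSet_Ioc] with s hs
    rw [← smul_sub, norm_smul, Real.norm_of_nonneg (hk t s hs), ← mul_add]
    refine mul_le_mul_of_nonneg_left ?_ (hk t s hs)
    have h1 := hlip t s hs.1.le hs.2 ht.2 (x s) (x' s) (u' s) (u' s) (huU' s) (huU' s)
    rw [sub_self, norm_zero, add_zero] at h1
    have h2 := norm_add_le (h t s (x s) (u s) - h t s (x s) (u' s))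
      (h t s (x s) (u' s) - h t s (x' s) (u' s))
    rw [sub_add_sub_cancel] at h2
    linarith
  · obtain ⟨X, hX0, hX⟩ := hbd x hx
    refine vol_pow_integrable T p (2 * (N₀ + X * N)) hp
      (fun t s => (t - s) ^ γ * ‖h t s (x s) (u s) - h t s (x s) (u' s)‖) ?_ ?_ ?_
    · have h1 := hjm x u hx hu
      have h2 := hjm x u' hx hu'
      have h3 := (h1.sub h2).norm
      have h4 : Measurable fun z : ℝ × ℝ => (z.1 - z.2) ^ γ := by fun_prop
      exact h4.mul h3
    · intro t ht s hs
      exact mul_nonneg (hk t s hs) (norm_nonneg _)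
    · intro t ht
      have hdom : IntegrableOn (fun s => (t - s) ^ γ * K₀ s + X * ((t - s) ^ γ * K s))
        (Ioc 0 t) := (hN₀ t ht).1.add ((hN t ht).1.const_mul X)
      have h1 : ∫ s in Ioc 0 t, (t - s) ^ γ * ‖h t s (x s) (u s) - h t s (x s) (u' s)‖
          ≤ ∫ s in Ioc 0 t, 2 * ((t - s) ^ γ * K₀ s + X * ((t - s) ^ γ * K s)) := by
        refine setIntegral_mono_on (hintn t ht) (hdom.const_mul 2) measurableSet_Ioc ?_
        intro s hs
        have h1 := hgrow x u X hX huU t ht s hs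
        have h2 := hgrow x u' X hX huU' t ht s hs
        have h3 := mul_le_mul_of_nonneg_left
          (norm_sub_le (h t s (x s) (u s)) (h t s (x s) (u' s))) (hk t s hs)
        rw [mul_add] at h3
        linarith
      rw [integral_const_mul, integral_add (hN₀ t ht).1 ((hN t ht).1.const_mul X),
        integral_const_mul] at h1
      have := mul_le_mul_of_nonneg_left (hN t ht).2 hX0
      linarith [(hN₀ t ht).2]

lemma five_rpow (p a b c d e : ℝ) (hp : 0 ≤ p) (ha : 0 ≤ a) (hb : 0 ≤ b) (hc : 0 ≤ c)
    (hd : 0 ≤ d) (he : 0 ≤ e) :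
    (a + b + c + d + e) ^ p ≤ 5 ^ p * (a ^ p + b ^ p + c ^ p + d ^ p + e ^ p) := by
  have key : ∀ m : ℝ, 0 ≤ m → a ≤ m → b ≤ m → c ≤ m → d ≤ m → e ≤ m →
      (a + b + c + d + e) ^ p ≤ 5 ^ p * m ^ p := by
    intro m hm h1 h2 h3 h4 h5
    rw [← Real.mul_rpow (by norm_num) hm]
    exact Real.rpow_le_rpow (by positivity) (by linarith) hp
  have h5 : (0:ℝ) ≤ 5 ^ p := by positivity
  have ha' := Real.rpow_nonneg ha p
  have hb' := Real.rpow_nonneg hb p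
  have hc' := Real.rpow_nonneg hc p
  have hd' := Real.rpow_nonneg hd p
  have he' := Real.rpow_nonneg he p
  obtain ⟨m, hm, h⟩ : ∃ m ∈ ({a, b, c, d, e} : Finset ℝ), ∀ z ∈ ({a, b, c, d, e} : Finset ℝ),
      z ≤ m := Finset.exists_max_image _ id ⟨a, by simp⟩
  have hk := key m (ha.trans (h a (by simp))) (h a (by simp)) (h b (by simp)) (h c (by simp))
    (h d (by simp)) (h e (by simp))
  refine hk.trans (mul_le_mul_of_nonneg_left ?_ h5)
  simp only [Finset.mem_insert, Finset.mem_singleton] at hm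
  rcases hm with rfl | rfl | rfl | rfl | rfl <;> linarith

lemma final_root (p T W δ I a b : ℝ) (hp1 : 1 ≤ p) (hT : 0 ≤ T) (hW0 : 0 ≤ W) (hδ0 : 0 ≤ δ)
    (ha : 0 ≤ a) (hb : 0 ≤ b) (hI : 0 ≤ I) (h : I ≤ W * (T * δ ^ p + a + b)) :
    I ^ (1 / p) ≤ W ^ (1 / p) * (T ^ (1 / p) + 1) * δ
      + W ^ (1 / p) * (T ^ (1 / p) + 1) * a ^ (1 / p)
      + W ^ (1 / p) * (T ^ (1 / p) + 1) * b ^ (1 / p) := by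
  have hp0 : 0 < p := by linarith
  have hWp : 0 ≤ W ^ (1 / p) := Real.rpow_nonneg hW0 _
  have hTp : 0 ≤ T ^ (1 / p) := Real.rpow_nonneg hT _
  have hδp : 0 ≤ T * δ ^ p := mul_nonneg hT (Real.rpow_nonneg hδ0 _)
  have hp' : 0 ≤ 1 / p := by positivity
  have hp'' : 1 / p ≤ 1 := by rw [div_le_one hp0]; exact hp1
  have hroot : I ^ (1 / p) ≤ W ^ (1 / p) *
      (T ^ (1 / p) * δ + a ^ (1 / p) + b ^ (1 / p)) := by
    refine (Real.rpow_le_rpow hI h hp').trans ?_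
    rw [Real.mul_rpow hW0 (by positivity)]
    refine mul_le_mul_of_nonneg_left ?_ hWp
    refine (Real.rpow_add_le_add_rpow (by positivity) hb hp' hp'').trans ?_
    refine add_le_add ((Real.rpow_add_le_add_rpow hδp ha hp' hp'').trans ?_) le_rfl
    rw [Real.mul_rpow hT (Real.rpow_nonneg hδ0 _), ← Real.rpow_mul hδ0,
      mul_one_div_cancel hp0.ne', Real.rpow_one]
  refine hroot.trans ?_
  have hrA := Real.rpow_nonneg ha (1 / p)
  have hrB := Real.rpow_nonneg hb (1 / p)
  have t1 := mul_nonneg hWp hδ0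
  have t2 := mul_nonneg (mul_nonneg hWp hTp) hrA
  have t3 := mul_nonneg (mul_nonneg hWp hTp) hrB
  linarith

set_option maxHeartbeats 1000000 in
/-- under Assumption A, there is a constant `C ≥ 0` such that for any initial
conditions `x₀, x₀'` and admissible controls `u, u'`, the corresponding solutions satisfy the
stated `Lᵖ` stability estimate. -/
theorem volterra_stability_estimate
    {n d : ℕ} (T : ℝ) (hT : 0 < T) (α : ℝ) (hα : α ∈ Set.Ioo (0:ℝ) 1)
    (p : ℝ) (hp1 : 1 ≤ p) (hp : 1 / α < p)
    (U : Set (Euc d)) (u₀ : Euc d) (hu₀U : u₀ ∈ U)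
    (f g : ℝ → ℝ → Euc n → Euc d → Euc n)
    (hf_meas : Measurable fun q : ℝ × ℝ × Euc n × Euc d => f q.1 q.2.1 q.2.2.1 q.2.2.2)
    (hg_meas : Measurable fun q : ℝ × ℝ × Euc n × Euc d => g q.1 q.2.1 q.2.2.1 q.2.2.2)
    -- Assumption A: continuity in the outer time variable
    (K' : ℝ) (hK'0 : 0 ≤ K')
    (ω : ℝ → ℝ) (hω_incr : MonotoneOn ω (Set.Ici 0)) (hω_nonneg : ∀ r, 0 ≤ ω r)
    (hω0 : ω 0 = 0) (hω_cont : ContinuousWithinAt ω (Set.Ici 0) 0)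
    (hA_t : ∀ t t' s : ℝ, 0 ≤ s → s ≤ t → t ≤ T → s ≤ t' → t' ≤ T →
      ∀ (x : Euc n) (u : Euc d), u ∈ U →
        ‖f t s x u - f t' s x u‖ + ‖g t s x u - g t' s x u‖ ≤ K' * ω |t - t'| * (1 + ‖x‖))
    -- Assumption A: Lipschitz-type conditions
    (K₀ K : ℝ → ℝ) (hK₀_nonneg : ∀ s, 0 ≤ K₀ s) (hK_nonneg : ∀ s, 0 ≤ K s)
    (hK₀_meas : Measurable K₀) (hK_meas : Measurable K)
    (r₀ : ℝ) (hr₀ : 1 / α < r₀) (hK₀_L : IntegrableOn (fun s => K₀ s ^ r₀) (Set.Ioc 0 T))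
    (r₁ : ℝ) (hr₁ : p / (α * p - 1) < r₁) (hK_L : IntegrableOn (fun s => K s ^ r₁) (Set.Ioc 0 T))
    (hA_lip : ∀ t s : ℝ, 0 ≤ s → s ≤ t → t ≤ T →
      ∀ (x x' : Euc n) (u u' : Euc d), u ∈ U → u' ∈ U →
        ‖f t s x u - f t s x' u'‖ + ‖g t s x u - g t s x' u'‖ ≤ K s * (‖x - x'‖ + ‖u - u'‖))
    (hA_zero : ∀ t s : ℝ, 0 ≤ s → s ≤ t → t ≤ T → ∀ u : Euc d, u ∈ U →
      ‖f t s 0 u‖ + ‖g t s 0 u‖ ≤ K₀ s) :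
    ∃ C : ℝ, 0 ≤ C ∧
      ∀ (x₀ x₀' : Euc n) (u u' : ℝ → Euc d),
        Admissible T p U u₀ u → Admissible T p U u₀ u' →
        ∀ x x' : ℝ → Euc n,
          ContinuousOn x (Set.Icc 0 T) → IsSolution T α f g x₀ u x →
          ContinuousOn x' (Set.Icc 0 T) → IsSolution T α f g x₀' u' x' →
          (∫ t in Set.Ioc 0 T, ‖x t - x' t‖ ^ p) ^ (1 / p)
            ≤ C * ‖x₀ - x₀'‖
              + C * (∫ t in Set.Ioc 0 T,
                  (∫ s in Set.Ioc 0 t,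
                    ((t - s) ^ (α - 1)) * ‖f t s (x s) (u s) - f t s (x s) (u' s)‖) ^ p) ^ (1 / p)
              + C * (∫ t in Set.Ioc 0 T,
                  (∫ s in Set.Ioc 0 t,
                    ‖g t s (x s) (u s) - g t s (x s) (u' s)‖) ^ p) ^ (1 / p) := by
  obtain ⟨hα0, hα1⟩ := hα
  have hp0 : 0 < p := by linarith
  have hαp : 1 < α * p := by rwa [div_lt_iff₀ hα0, mul_comm] at hp
  have hp1' : 1 < p := by nlinarith
  have hexp : ∀ γ r : ℝ, α - 1 ≤ γ → 1 / α < r → 1 < r ∧ -1 < γ * (r / (r - 1)) := by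
    intro γ r hγ hr
    rw [div_lt_iff₀ hα0] at hr
    have hr1 : 1 < r := by nlinarith
    refine ⟨hr1, ?_⟩
    rw [← mul_div_assoc, lt_div_iff₀ (by linarith)]
    nlinarith
  have hr₁' : 1 / α < r₁ := by
    refine lt_trans ?_ hr₁
    rw [div_lt_div_iff₀ hα0 (by linarith)]
    linarith
  have h0α : α - 1 ≤ 0 := by linarith
  obtain ⟨N₀, -, hN₀⟩ := kern_bound T (α - 1) r₀ hT.le (hexp _ _ le_rfl hr₀).1
    (hexp _ _ le_rfl hr₀).2 K₀ hK₀_nonneg hK₀_meas hK₀_L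
  obtain ⟨N, -, hN⟩ := kern_bound T (α - 1) r₁ hT.le (hexp _ _ le_rfl hr₁').1
    (hexp _ _ le_rfl hr₁').2 K hK_nonneg hK_meas hK_L
  obtain ⟨N₀', -, hN₀'⟩ := kern_bound T 0 r₀ hT.le (hexp _ _ h0α hr₀).1
    (hexp _ _ h0α hr₀).2 K₀ hK₀_nonneg hK₀_meas hK₀_L
  obtain ⟨N', -, hN'⟩ := kern_bound T 0 r₁ hT.le (hexp _ _ h0α hr₁').1
    (hexp _ _ h0α hr₁').2 K hK_nonneg hK_meas hK_L
  obtain ⟨M₁, hM₁0, hM₁⟩ := holder_bound T α p (α - 1) r₁ hT.le hα1 hp1' hαp le_rfl hr₁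
    K hK_nonneg hK_meas hK_L
  obtain ⟨M₂, hM₂0, hM₂⟩ := holder_bound T α p 0 r₁ hT.le hα1 hp1' hαp h0α hr₁
    K hK_nonneg hK_meas hK_L
  set L := 5 ^ p * (M₁ + M₂) with hLdef
  have h5 : (0:ℝ) ≤ 5 ^ p := by positivity
  have hL : 0 ≤ L := by positivity
  set W := 5 ^ p * Real.exp (L * T) with hW
  have hW0 : 0 ≤ W := by positivity
  have hWp : 0 ≤ W ^ (1 / p) := Real.rpow_nonneg hW0 _
  have hTp : 0 ≤ T ^ (1 / p) := Real.rpow_nonneg hT.le _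
  refine ⟨W ^ (1 / p) * (T ^ (1 / p) + 1), by positivity, ?_⟩
  intro x₀ x₀' u u' hu hu'
  have key : ∀ x x' : ℝ → Euc n, Continuous x → Continuous x' →
      IsSolution T α f g x₀ u x → IsSolution T α f g x₀' u' x' →
      (∫ t in Set.Ioc 0 T, ‖x t - x' t‖ ^ p) ^ (1 / p)
            ≤ W ^ (1 / p) * (T ^ (1 / p) + 1) * ‖x₀ - x₀'‖
              + W ^ (1 / p) * (T ^ (1 / p) + 1) * (∫ t in Set.Ioc 0 T,
                  (∫ s in Set.Ioc 0 t,
                    ((t - s) ^ (α - 1)) * ‖f t s (x s) (u s) - f t s (x s) (u' s)‖) ^ p) ^ (1 / p)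
              + W ^ (1 / p) * (T ^ (1 / p) + 1) * (∫ t in Set.Ioc 0 T,
                  (∫ s in Set.Ioc 0 t,
                    ‖g t s (x s) (u s) - g t s (x s) (u' s)‖) ^ p) ^ (1 / p) := by
    intro x x' hx hx' hs hs'
    obtain ⟨hf1, hf2⟩ := one_kernel T p (α - 1) hp0.le U f hf_meas K₀ K hK_nonneg
      (fun t s h1 h2 h3 y y' v v' hv hv' => le_trans (le_add_of_nonneg_right (norm_nonneg _))
        (hA_lip t s h1 h2 h3 y y' v v' hv hv'))
      (fun t s h1 h2 h3 v hv => le_trans (le_add_of_nonneg_right (norm_nonneg _))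
        (hA_zero t s h1 h2 h3 v hv)) N₀ N hN₀ hN x x' hx hx' u u' hu.1 hu'.1 hu.2.1 hu'.2.1
    obtain ⟨hg1, hg2⟩ := one_kernel T p 0 hp0.le U g hg_meas K₀ K hK_nonneg
      (fun t s h1 h2 h3 y y' v v' hv hv' => le_trans (le_add_of_nonneg_left (norm_nonneg _))
        (hA_lip t s h1 h2 h3 y y' v v' hv hv'))
      (fun t s h1 h2 h3 v hv => le_trans (le_add_of_nonneg_left (norm_nonneg _))
        (hA_zero t s h1 h2 h3 v hv)) N₀' N' hN₀' hN' x x' hx hx' u u' hu.1 hu'.1 hu.2.1 hu'.2.1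
    have hec : Continuous fun s => ‖x s - x' s‖ := by fun_prop
    have hM₁' := fun t ht => hM₁ t ht _ hec (fun s => norm_nonneg _)
    have hM₂' := fun t ht => hM₂ t ht _ hec (fun s => norm_nonneg _)
    simp only [Real.rpow_zero, one_smul, one_mul] at hg1 hg2 hM₂'
    set A : ℝ → ℝ := fun t => ∫ s in Set.Ioc 0 t,
      ((t - s) ^ (α - 1)) * ‖f t s (x s) (u s) - f t s (x s) (u' s)‖ with hA
    set B : ℝ → ℝ := fun t => ∫ s in Set.Ioc 0 t,
      ‖g t s (x s) (u s) - g t s (x s) (u' s)‖ with hB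
    have hA0 : ∀ t, 0 ≤ A t := fun t => setIntegral_nonneg measurableSet_Ioc fun s hs =>
      mul_nonneg (Real.rpow_nonneg (sub_nonneg.2 hs.2) _) (norm_nonneg _)
    have hB0 : ∀ t, 0 ≤ B t := fun t => integral_nonneg fun s => norm_nonneg _
    set δ := ‖x₀ - x₀'‖ with hδ
    have hδ0 : 0 ≤ δ := norm_nonneg _
    have hE := gronwall_int T L hT hL (fun t => ‖x t - x' t‖ ^ p)
      (fun t => 5 ^ p * (δ ^ p + A t ^ p + B t ^ p))
      (hec.rpow_const fun s => Or.inr hp0.le) (fun s => Real.rpow_nonneg (norm_nonneg _) _)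
      (fun t _ => mul_nonneg h5 (add_nonneg (add_nonneg (Real.rpow_nonneg hδ0 _)
        (Real.rpow_nonneg (hA0 t) _)) (Real.rpow_nonneg (hB0 t) _)))
      ((((integrableOn_const (by simp)).add hf2).add hg2).const_mul _)
      (by
        filter_upwards [hs, hs', ae_restrict_mem measurableSet_Ioc] with t h1 h2 ht
        have hI1 : 0 ≤ ∫ s in Ioc 0 t, (t - s) ^ (α - 1) * (K s * ‖x s - x' s‖) :=
          setIntegral_nonneg measurableSet_Ioc fun s hs =>
            mul_nonneg (Real.rpow_nonneg (sub_nonneg.2 hs.2) _)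
              (mul_nonneg (hK_nonneg s) (norm_nonneg _))
        have hI2 : 0 ≤ ∫ s in Ioc 0 t, K s * ‖x s - x' s‖ :=
          integral_nonneg fun s => mul_nonneg (hK_nonneg s) (norm_nonneg _)
        have hle : ‖x t - x' t‖ ≤ δ + A t + B t
            + (∫ s in Ioc 0 t, (t - s) ^ (α - 1) * (K s * ‖x s - x' s‖))
            + ∫ s in Ioc 0 t, K s * ‖x s - x' s‖ := by
          have e1 : x t - x' t = (x₀ - x₀')
            + ((∫ s in Set.Ioc 0 t, ((t - s) ^ (α - 1)) • f t s (x s) (u s))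
              - ∫ s in Set.Ioc 0 t, ((t - s) ^ (α - 1)) • f t s (x' s) (u' s))
            + ((∫ s in Set.Ioc 0 t, g t s (x s) (u s))
              - ∫ s in Set.Ioc 0 t, g t s (x' s) (u' s)) := by
            rw [h1, h2]; abel
          rw [e1]
          refine (norm_add₃_le).trans ?_
          have := hf1 t ht
          have := hg1 t ht
          linarith
        have h6 := (Real.rpow_le_rpow (norm_nonneg _) hle hp0.le).trans
          (five_rpow p _ _ _ _ _ hp0.le hδ0 (hA0 t) (hB0 t) hI1 hI2)
        refine h6.trans ?_
        have h7 := mul_le_mul_of_nonneg_left (add_le_add (hM₁' t ht) (hM₂' t ht)) h5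
        rw [hLdef]
        linarith)
    have hA2 : IntegrableOn (fun t => A t ^ p) (Ioc 0 T) := hf2
    have hB2 : IntegrableOn (fun t => B t ^ p) (Ioc 0 T) := hg2
    have hC2 : IntegrableOn (fun _ : ℝ => δ ^ p) (Ioc 0 T) := integrableOn_const (by simp)
    have hAC : IntegrableOn (fun t => δ ^ p + A t ^ p) (Ioc 0 T) := hC2.add hA2
    rw [integral_const_mul, integral_add hAC hB2, integral_add hC2 hA2, setIntegral_const] at hE
    have hIA : 0 ≤ ∫ t in Ioc 0 T, A t ^ p := integral_nonneg fun t => Real.rpow_nonneg (hA0 t) _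
    have hIB : 0 ≤ ∫ t in Ioc 0 T, B t ^ p := integral_nonneg fun t => Real.rpow_nonneg (hB0 t) _
    have hE0 : 0 ≤ ∫ t in Ioc 0 T, ‖x t - x' t‖ ^ p :=
      integral_nonneg fun t => Real.rpow_nonneg (norm_nonneg _) _
    have hvol : (volume : Measure ℝ).real (Ioc 0 T) = T := by
      simp [Measure.real, hT.le]
    rw [hvol, smul_eq_mul] at hE
    refine final_root p T W δ _ _ _ hp1 hT.le hW0 hδ0 hIA hIB hE0 ?_
    rw [hW]
    linarith
  intro x x' hx hs hx' hs'
  set y : ℝ → Euc n := IccExtend hT.le ((Icc 0 T).domRestrict x) with hy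
  set y' : ℝ → Euc n := IccExtend hT.le ((Icc 0 T).domRestrict x') with hy'
  have hyx : ∀ s ∈ Icc 0 T, y s = x s := fun s hs => IccExtend_of_mem hT.le _ hs
  have hyx' : ∀ s ∈ Icc 0 T, y' s = x' s := fun s hs => IccExtend_of_mem hT.le _ hs
  have hyc : Continuous y := hx.domRestrict.Icc_extend'
  have hyc' : Continuous y' := hx'.domRestrict.Icc_extend'
  have hsol : ∀ (z₀ : Euc n) (v : ℝ → Euc d) (z w : ℝ → Euc n), (∀ s ∈ Icc 0 T, w s = z s) →
      IsSolution T α f g z₀ v z → IsSolution T α f g z₀ v w := by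
    intro z₀ v z w hzw hz
    unfold IsSolution at hz ⊢
    filter_upwards [hz, ae_restrict_mem measurableSet_Ioc] with t h1 ht
    rw [hzw t ⟨ht.1.le, ht.2⟩, h1]
    congr 1
    · congr 1
      refine setIntegral_congr_fun measurableSet_Ioc fun s hs => ?_
      simp only [hzw s ⟨hs.1.le, hs.2.trans ht.2⟩]
    · refine setIntegral_congr_fun measurableSet_Ioc fun s hs => ?_
      simp only [hzw s ⟨hs.1.le, hs.2.trans ht.2⟩]
  have hfin := key y y' hyc hyc' (hsol _ _ _ _ hyx hs) (hsol _ _ _ _ hyx' hs')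
  have c1 : ∫ t in Ioc 0 T, ‖y t - y' t‖ ^ p = ∫ t in Ioc 0 T, ‖x t - x' t‖ ^ p :=
    setIntegral_congr_fun measurableSet_Ioc fun t ht => by
      simp only [hyx t ⟨ht.1.le, ht.2⟩, hyx' t ⟨ht.1.le, ht.2⟩]
  have c2 : ∫ t in Ioc 0 T, (∫ s in Ioc 0 t,
        ((t - s) ^ (α - 1)) * ‖f t s (y s) (u s) - f t s (y s) (u' s)‖) ^ p
      = ∫ t in Ioc 0 T, (∫ s in Ioc 0 t,
        ((t - s) ^ (α - 1)) * ‖f t s (x s) (u s) - f t s (x s) (u' s)‖) ^ p := by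
    refine setIntegral_congr_fun measurableSet_Ioc fun t ht => ?_
    refine congrArg (fun z : ℝ => z ^ p) ?_
    refine setIntegral_congr_fun measurableSet_Ioc fun s hs => ?_
    simp only [hyx s ⟨hs.1.le, hs.2.trans ht.2⟩]
  have c3 : ∫ t in Ioc 0 T, (∫ s in Ioc 0 t,
        ‖g t s (y s) (u s) - g t s (y s) (u' s)‖) ^ p
      = ∫ t in Ioc 0 T, (∫ s in Ioc 0 t,
        ‖g t s (x s) (u s) - g t s (x s) (u' s)‖) ^ p := by
    refine setIntegral_congr_fun measurableSet_Ioc fun t ht => ?_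
    refine congrArg (fun z : ℝ => z ^ p) ?_
    refine setIntegral_congr_fun measurableSet_Ioc fun s hs => ?_
    simp only [hyx s ⟨hs.1.le, hs.2.trans ht.2⟩]
  rw [c1, c2, c3] at hfin
  exact hfin
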